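/- arXiv:2603.19705 — 3 statements merged into one kernel-verified Lean document; each statement's English description precedes it below -/
import Mathlib

section
/- Correctness of the general achievable scheme. For every admissible pattern, the server can decode the desired sum with zero error from the messages of the surviving relays: H[∑_{(u,v)∈𝒮¹} W_{u,v} | ({Y¹_u}_{u∈𝒰¹}, {Y²_u}_{u∈𝒰²})] = 0; equivalently, ∑_{(u,v)∈𝒮¹} W_{u,v} is almost surely a deterministic function of ({Y¹_u}_{u∈𝒰¹}, {Y²_u}_{u∈𝒰²}). -/
open MeasureTheory Finset

/-- Shannon entropy (in nats) of a finitely-valued random variable. -/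
noncomputable def ent {Ω : Type*} [MeasurableSpace Ω] (μ : Measure Ω)
    {α : Type*} [Fintype α] (X : Ω → α) : ℝ :=
  ∑ a : α, Real.negMulLog (μ (X ⁻¹' {a})).toReal

/-- Conditional Shannon entropy H[X | Y]. -/
noncomputable def condEnt {Ω : Type*} [MeasurableSpace Ω] (μ : Measure Ω)
    {α β : Type*} [Fintype α] [Fintype β] (X : Ω → α) (Y : Ω → β) : ℝ :=
  ent μ (fun ω => (X ω, Y ω)) - ent μ Y

/-- Mutual information I[X ; Y]. -/
noncomputable def mutInfo {Ω : Type*} [MeasurableSpace Ω] (μ : Measure Ω)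
    {α β : Type*} [Fintype α] [Fintype β] (X : Ω → α) (Y : Ω → β) : ℝ :=
  ent μ X + ent μ Y - ent μ (fun ω => (X ω, Y ω))

/-- Conditional mutual information I[X ; Y | Z]. -/
noncomputable def condMutInfo {Ω : Type*} [MeasurableSpace Ω] (μ : Measure Ω)
    {α β γ : Type*} [Fintype α] [Fintype β] [Fintype γ]
    (X : Ω → α) (Y : Ω → β) (Z : Ω → γ) : ℝ :=
  ent μ (fun ω => (X ω, Z ω)) + ent μ (fun ω => (Y ω, Z ω))
    - ent μ (fun ω => (X ω, Y ω, Z ω)) - ent μ Z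

/-- A finitely-valued random variable is uniformly distributed. -/
def IsUnif {Ω : Type*} [MeasurableSpace Ω] (μ : Measure Ω)
    {α : Type*} [Fintype α] (X : Ω → α) : Prop :=
  ∀ a : α, μ (X ⁻¹' {a}) = (Fintype.card α : ENNReal)⁻¹

/-- Independence of two finitely-valued random variables. -/
def IndepRV {Ω : Type*} [MeasurableSpace Ω] (μ : Measure Ω)
    {α β : Type*} (X : Ω → α) (Y : Ω → β) : Prop :=
  ∀ a b, μ (X ⁻¹' {a} ∩ Y ⁻¹' {b}) = μ (X ⁻¹' {a}) * μ (Y ⁻¹' {b})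

/-- Mutual independence of a finite family of finitely-valued random variables. -/
def iIndepRV {Ω : Type*} [MeasurableSpace Ω] (μ : Measure Ω)
    {ι : Type*} [Fintype ι] {α : ι → Type*} (X : ∀ i, Ω → α i) : Prop :=
  ∀ a : ∀ i, α i, μ (⋂ i, X i ⁻¹' {a i}) = ∏ i, μ (X i ⁻¹' {a i})

/-- The first `m` indices of `Fin n`, as a `Finset`. -/
def firstSeg (n m : ℕ) : Finset (Fin n) := Finset.univ.filter fun x => (x : ℕ) < m

/-- A dropout/survival pattern: surviving users `V1 u ⊇ V2 u` (rounds 1 and 2) for each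
relay `u`, surviving relays `U1 ⊇ U2` (rounds 1 and 2). -/
structure Pattern (U V U₀ V₀ : ℕ) where
  V1 : Fin U → Finset (Fin V)
  V2 : Fin U → Finset (Fin V)
  U1 : Finset (Fin U)
  U2 : Finset (Fin U)
  hVsub : ∀ u, V2 u ⊆ V1 u
  hVcard : ∀ u, V₀ ≤ (V2 u).card
  hUsub : U2 ⊆ U1
  hUcard : U₀ ≤ U2.card

/-- The set of users surviving the first round: `𝒮¹ = ∪_{u ∈ 𝒰¹} 𝒱¹_u`. -/
def Pattern.S1 {U V U₀ V₀ : ℕ} (P : Pattern U V U₀ V₀) : Finset (Fin U × Fin V) :=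
  P.U1.biUnion fun u => (P.V1 u).image fun v => (u, v)

/-- A two-round hierarchical secure-aggregation scheme with message lengths
`(LX1, LY1, LX2, LY2)`, over inputs `W` and secret keys `Z`. -/
structure Scheme (U V U₀ V₀ L : ℕ) (F : Type*) (K : Fin U × Fin V → Type*)
    (Ω : Type*) (W : Fin U × Fin V → Ω → Fin L → F)
    (Z : (i : Fin U × Fin V) → Ω → K i) (LX1 LY1 LX2 LY2 : ℕ) where
  /-- First-round user messages. -/
  X1 : Fin U × Fin V → Ω → Fin LX1 → F
  hX1 : ∀ i, ∃ φ : (Fin L → F) → K i → Fin LX1 → F, ∀ ω, X1 i ω = φ (W i ω) (Z i ω)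
  /-- First-round relay messages (per admissible pattern). -/
  Y1 : Pattern U V U₀ V₀ → Fin U → Ω → Fin LY1 → F
  hY1 : ∀ P u, ∃ g : ({v // v ∈ P.V1 u} → Fin LX1 → F) → Fin LY1 → F,
      ∀ ω, Y1 P u ω = g fun v => X1 (u, v.1) ω
  /-- Second-round user messages; the encoder may depend on `𝒮¹`. -/
  X2 : Finset (Fin U × Fin V) → Fin U × Fin V → Ω → Fin LX2 → F
  hX2 : ∀ S i, ∃ ψ : (Fin L → F) → K i → Fin LX2 → F, ∀ ω, X2 S i ω = ψ (W i ω) (Z i ω)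
  /-- Second-round relay messages (per admissible pattern). -/
  Y2 : Pattern U V U₀ V₀ → Fin U → Ω → Fin LY2 → F
  hY2 : ∀ P u, ∃ g : ({v // v ∈ P.V2 u} → Fin LX2 → F) → Fin LY2 → F,
      ∀ ω, Y2 P u ω = g fun v => X2 P.S1 (u, v.1) ω

section SchemePredicates

variable {U V U₀ V₀ L : ℕ} {F : Type*} [Fintype F] [AddCommMonoid F]
  {K : Fin U × Fin V → Type*} [∀ i, Fintype (K i)]
  {Ω : Type*} [MeasurableSpace Ω]
  {W : Fin U × Fin V → Ω → Fin L → F} {Z : (i : Fin U × Fin V) → Ω → K i}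
  {LX1 LY1 LX2 LY2 : ℕ}

/-- Correctness: for every admissible pattern, the server decodes
`∑_{(u,v)∈𝒮¹} W_{u,v}` from `{Y¹_u}_{u∈𝒰¹}, {Y²_u}_{u∈𝒰²}` with zero error. -/
def Scheme.Correct (S : Scheme U V U₀ V₀ L F K Ω W Z LX1 LY1 LX2 LY2)
    (μ : Measure Ω) : Prop :=
  ∀ P : Pattern U V U₀ V₀,
    condEnt μ (fun ω => ∑ i ∈ P.S1, W i ω)
      (fun ω => ((fun u : {u // u ∈ P.U1} => S.Y1 P u.1 ω),
                 (fun u : {u // u ∈ P.U2} => S.Y2 P u.1 ω))) = 0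

/-- Server security against collusion with at most `T` users,
under the delayed message availability model. -/
def Scheme.ServerSecure (S : Scheme U V U₀ V₀ L F K Ω W Z LX1 LY1 LX2 LY2)
    (μ : Measure Ω) (T : ℕ) : Prop :=
  ∀ (P : Pattern U V U₀ V₀) (𝒯 : Finset (Fin U × Fin V)), 𝒯.card ≤ T →
    condMutInfo μ
      (fun ω => ((fun u : Fin U => S.Y1 P u ω),
                 (fun u : {u // u ∈ P.U1} => S.Y2 P u.1 ω)))
      (fun ω => fun i : Fin U × Fin V => W i ω)
      (fun ω => ((∑ i ∈ P.S1, W i ω),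
                 (fun i : {i // i ∈ 𝒯} => (W i.1 ω, Z i.1 ω)))) = 0

/-- Relay security against collusion with at most `T` users,
under the delayed message availability model. -/
def Scheme.RelaySecure (S : Scheme U V U₀ V₀ L F K Ω W Z LX1 LY1 LX2 LY2)
    (μ : Measure Ω) (T : ℕ) : Prop :=
  ∀ (u : Fin U) (P : Pattern U V U₀ V₀) (𝒯 : Finset (Fin U × Fin V)), 𝒯.card ≤ T →
    condMutInfo μ
      (fun ω => ((fun v : Fin V => S.X1 (u, v) ω),
                 (fun v : {v // v ∈ P.V1 u} => S.X2 P.S1 (u, v.1) ω)))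
      (fun ω => fun i : Fin U × Fin V => W i ω)
      (fun ω => fun i : {i // i ∈ 𝒯} => (W i.1 ω, Z i.1 ω)) = 0

end SchemePredicates

/-- An MDS matrix: every maximal square submatrix (any choice of `k` distinct columns)
is invertible. -/
def IsMDS {k : ℕ} {F : Type*} [CommRing F] {ι : Type*} [DecidableEq ι]
    (α : Matrix (Fin k) ι F) : Prop :=
  ∀ cols : Fin k → ι, Function.Injective cols →
    IsUnit (Matrix.of fun i j : Fin k => α i (cols j)).det

/-- A `T`-private matrix: every `T×T` submatrix of the matrix formed by the
last `T` rows is invertible. -/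
def IsTPrivate {k : ℕ} {F : Type*} [CommRing F] {ι : Type*} [DecidableEq ι]
    (α : Matrix (Fin k) ι F) (T : ℕ) (hT : T ≤ k) : Prop :=
  ∀ cols : Fin T → ι, Function.Injective cols →
    IsUnit (Matrix.of fun i j : Fin T =>
      α (⟨k - T + i.val, by omega⟩ : Fin k) (cols j)).det

/-- The key projection `[Q_{ij}]_{uv} := (N_{ij}(1),…,N_{ij}(L),S_{ij}(1),…,S_{ij}(T))·α_{uv}`. -/
def QQ {Ω : Type*} {F : Type*} [CommRing F] {ι : Type*} {L T k : ℕ} (hk : k = L + T)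
    (α : Matrix (Fin k) ι F) (N : ι → Ω → Fin L → F) (S : ι → Ω → Fin T → F)
    (ij : ι) (uv : ι) (ω : Ω) : F :=
  ∑ r : Fin k,
    (if h : r.val < L then N ij ω ⟨r.val, h⟩ else S ij ω ⟨r.val - L, by omega⟩) * α r uv

/-- The joint family of two families of random variables, indexed by a sum type. -/
def pairFam {ι Ω : Type*} {A B : Type u} (N : ι → Ω → A) (S : ι → Ω → B) :
    (s : ι ⊕ ι) → Ω → Sum.elim (fun _ : ι => A) (fun _ : ι => B) s
  | Sum.inl i => N i
  | Sum.inr i => S i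

/-- The joint family of three families of random variables, indexed by a sum type. -/
def tripleFam {ι Ω : Type*} {A B C : Type u} (X : ι → Ω → A) (Y : ι → Ω → B) (Z : ι → Ω → C) :
    (s : ι ⊕ ι ⊕ ι) → Ω →
      Sum.elim (fun _ : ι => A) (Sum.elim (fun _ : ι => B) (fun _ : ι => C)) s
  | Sum.inl i => X i
  | Sum.inr (Sum.inl i) => Y i
  | Sum.inr (Sum.inr i) => Z i

theorem condEnt_eq_zero_of_determined {Ω : Type*} [MeasurableSpace Ω] (μ : Measure Ω)
    {α β : Type*} [Fintype α] [Fintype β] (X : Ω → α) (Y : Ω → β)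
    (h : ∀ ω ω', Y ω = Y ω' → X ω = X ω') : condEnt μ X Y = 0 := by
  rw [condEnt, sub_eq_zero, ent, ent, Fintype.sum_prod_type_right]
  refine Finset.sum_congr rfl fun y _ => ?_
  by_cases hy : ∃ ω, Y ω = y
  · obtain ⟨ω, rfl⟩ := hy
    rw [Finset.sum_eq_single (X ω)]
    · congr 3
      ext ω'
      simp only [Set.mem_preimage, Set.mem_singleton_iff, Prod.mk.injEq, and_iff_right_iff_imp]
      exact h ω' ω
    · intro x _ hx
      have hempty : (fun ω => (X ω, Y ω)) ⁻¹' {(x, Y ω)} = ∅ := by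
        ext ω'
        simp only [Set.mem_preimage, Set.mem_singleton_iff, Prod.mk.injEq, Set.mem_empty_iff_false,
          iff_false, not_and]
        exact fun hx' hy' => hx (hx'.symm.trans (h ω' ω hy'))
      simp [hempty]
    · simp
  · have hY : Y ⁻¹' {y} = ∅ := by
      ext ω
      simpa using fun h => hy ⟨ω, h⟩
    have hXY (x : α) : (fun ω => (X ω, Y ω)) ⁻¹' {(x, y)} = ∅ := by
      ext ω
      simpa using fun _ h => hy ⟨ω, h⟩
    simp [hY, hXY]

/-- A vector is determined by its inner products with any `k` columns of an MDS matrix. -/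
theorem IsMDS.eq_of_vecMul_eq {k : ℕ} {F : Type*} [Field F] {ι : Type*} [DecidableEq ι]
    {α : Matrix (Fin k) ι F} (hα : IsMDS α) {C : Finset ι} (hC : k ≤ C.card) {x y : Fin k → F}
    (h : ∀ c ∈ C, ∑ r, x r * α r c = ∑ r, y r * α r c) : x = y := by
  obtain ⟨D, hDC, hD⟩ := Finset.exists_subset_card_eq hC
  let e := D.equivFinOfCardEq hD
  have hdet := hα (fun j => (e.symm j : ι)) (Subtype.val_injective.comp e.symm.injective)
  refine Matrix.vecMul_injective_of_isUnit ((Matrix.isUnit_iff_isUnit_det _).2 hdet) ?_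
  funext j
  exact h _ (hDC (e.symm j).2)

theorem Pattern.sum_S1 {U V U₀ V₀ : ℕ} (P : Pattern U V U₀ V₀) {M : Type*} [AddCommMonoid M]
    (f : Fin U × Fin V → M) :
    ∑ i ∈ P.S1, f i = ∑ u ∈ P.U1, ∑ v ∈ P.V1 u, f (u, v) := by
  have hS : P.S1 = (P.U1.sigma fun u => P.V1 u).map
      (Equiv.sigmaEquivProd (Fin U) (Fin V)).toEmbedding := by
    ext ⟨u, v⟩
    simp [Pattern.S1]
  rw [hS, Finset.sum_map, Finset.sum_sigma]
  rfl

/-- Summing key projections over users gives the projection of the summed keys. -/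
theorem sum_QQ {Ω : Type*} {F : Type*} [CommRing F] {ι : Type*} {L T k : ℕ} (hk : k = L + T)
    (α : Matrix (Fin k) ι F) (N : ι → Ω → Fin L → F) (S : ι → Ω → Fin T → F)
    (A : Finset ι) (c : ι) (ω : Ω) :
    ∑ i ∈ A, QQ hk α N S i c ω = ∑ r : Fin k,
      (∑ i ∈ A, if h : r.val < L then N i ω ⟨r.val, h⟩ else S i ω ⟨r.val - L, by omega⟩) *
        α r c := by
  simp only [QQ, Finset.sum_mul]
  exact Finset.sum_comm

/-- **Correctness of the general achievable scheme.** For every admissible pattern, the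
server decodes `∑_{(u,v)∈𝒮¹} W_{u,v}` with zero error from the surviving relays'
messages `({Y¹_u}_{u∈𝒰¹}, {Y²_u}_{u∈𝒰²})`. -/
theorem general_scheme_correctness
    {Ω : Type} [MeasurableSpace Ω] (μ : Measure Ω) [IsProbabilityMeasure μ]
    (F : Type) [Field F] [Fintype F]
    (U V U₀ V₀ T L k : ℕ) (hU : 2 ≤ U) (hV : 2 ≤ V)
    (hU₀ : 1 ≤ U₀) (hU₀' : U₀ ≤ U - 1) (hV₀ : 1 ≤ V₀) (hV₀' : V₀ ≤ V - 1)
    (hT : T < U₀ * V₀) (hkUV : k = U₀ * V₀) (hkLT : k = L + T) (hTk : T ≤ k)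
    (α : Matrix (Fin k) (Fin U × Fin V) F)
    (hαMDS : IsMDS α) (hαpriv : IsTPrivate α T hTk)
    (W N : Fin U × Fin V → Ω → Fin L → F) (S : Fin U × Fin V → Ω → Fin T → F)
    (hindep : iIndepRV μ (tripleFam W N S))
    (hWunif : ∀ i, IsUnif μ (W i)) (hNunif : ∀ i, IsUnif μ (N i))
    (hSunif : ∀ i, IsUnif μ (S i))
    (P : Pattern U V U₀ V₀)
    (Q : Fin U → Finset (Fin V)) (hQsub : ∀ u, Q u ⊆ P.V2 u)
    (hQcard : ∀ u, (Q u).card = V₀) :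
    condEnt μ (fun ω => ∑ i ∈ P.S1, W i ω)
      (fun ω =>
        ((fun u : {u // u ∈ P.U1} => ∑ v ∈ P.V1 u.1, (W (u.1, v) ω + N (u.1, v) ω)),
         (fun u : {u // u ∈ P.U2} => fun v : {v // v ∈ Q u.1} =>
            ∑ ij ∈ P.S1, QQ hkLT α N S ij (u.1, v.1) ω))) = 0 := by
  apply condEnt_eq_zero_of_determined
  intro ω ω' h
  obtain ⟨h₁, h₂⟩ := Prod.mk.inj h
  have hWN : ∑ i ∈ P.S1, (W i ω + N i ω) = ∑ i ∈ P.S1, (W i ω' + N i ω') := by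
    rw [P.sum_S1, P.sum_S1]
    exact Finset.sum_congr rfl fun u hu => congrFun h₁ ⟨u, hu⟩
  let C := (P.U2.sigma Q).map (Equiv.sigmaEquivProd (Fin U) (Fin V)).toEmbedding
  have hC : k ≤ C.card := by
    rw [Finset.card_map, Finset.card_sigma, Finset.sum_congr rfl fun u _ => hQcard u,
      Finset.sum_const, smul_eq_mul, hkUV]
    exact Nat.mul_le_mul_right _ P.hUcard
  have hkey := hαMDS.eq_of_vecMul_eq hC
    (x := fun r => ∑ i ∈ P.S1,
      if h : r.val < L then N i ω ⟨r.val, h⟩ else S i ω ⟨r.val - L, by omega⟩)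
    (y := fun r => ∑ i ∈ P.S1,
      if h : r.val < L then N i ω' ⟨r.val, h⟩ else S i ω' ⟨r.val - L, by omega⟩) (by
    rintro ⟨u, v⟩ hc
    obtain ⟨hu, hv⟩ : u ∈ P.U2 ∧ v ∈ Q u := by simpa [C] using hc
    rw [← sum_QQ hkLT, ← sum_QQ hkLT]
    exact congrFun (congrFun h₂ ⟨u, hu⟩) ⟨v, hv⟩)
  have hN : ∑ i ∈ P.S1, N i ω = ∑ i ∈ P.S1, N i ω' := by
    funext l
    simpa using congrFun hkey ⟨l, by omega⟩
  rw [Finset.sum_add_distrib, Finset.sum_add_distrib, hN] at hWN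
  exact add_right_cancel hWN
end

section
/- Server security of the general achievable scheme. For every admissible pattern and every set 𝒯 ⊆ [U]×[V] with |𝒯| ≤ T: I[({Y¹_u}_{u∈[U]}, {Y²_u}_{u∈𝒰¹}); (W_{u,v})_{(u,v)∈[U]×[V]} | (∑_{(u,v)∈𝒮¹} W_{u,v}, {(W_{u,v}, Z_{u,v})}_{(u,v)∈𝒯})] = 0; that is, even under the delayed message availability model, the server colluding with at most T users learns nothing about the users' inputs beyond the desired sum and the colluding users' own inputs and keys. -/
open MeasureTheory Finset

/-- For a uniform finitely-valued variable, preimages of arbitrary sets have the expected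
measure, even without any measurability assumption. -/
theorem IsUnif.measure_preimage {Ω : Type*} [MeasurableSpace Ω] {μ : Measure Ω}
    [IsProbabilityMeasure μ] {E : Type*} [Fintype E] [Nonempty E] {Θ : Ω → E}
    (h : IsUnif μ Θ) (A : Finset E) :
    (μ (Θ ⁻¹' (A : Set E))).toReal = (A.card : ℝ) / Fintype.card E := by
  classical
  have hcard : (0 : ℝ) < Fintype.card E := by exact_mod_cast Fintype.card_pos
  have hle (B : Finset E) : μ.real (Θ ⁻¹' (B : Set E)) ≤ (B.card : ℝ) / Fintype.card E := by
    have hB : Θ ⁻¹' (B : Set E) = ⋃ b ∈ B, Θ ⁻¹' {b} := by ext; simp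
    rw [hB]
    refine (measureReal_biUnion_finset_le B _).trans_eq ?_
    simp [Measure.real, h _, div_eq_mul_inv]
  have hunion : (1 : ℝ) ≤ μ.real (Θ ⁻¹' (A : Set E)) + μ.real (Θ ⁻¹' ((Aᶜ : Finset E) : Set E)) := by
    have := measureReal_union_le (μ := μ) (Θ ⁻¹' (A : Set E)) (Θ ⁻¹' ((Aᶜ : Finset E) : Set E))
    rwa [← Set.preimage_union, Finset.coe_compl, Set.union_compl_self, Set.preimage_univ,
      probReal_univ, ← Finset.coe_compl] at this
  have hsum : (A.card : ℝ) / Fintype.card E + ((Aᶜ).card : ℝ) / Fintype.card E = 1 := by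
    rw [← add_div, div_eq_one_iff_eq hcard.ne']
    exact_mod_cast Finset.card_add_card_compl A
  have h₁ := hle A
  have h₂ := hle Aᶜ
  change μ.real _ = _
  linarith

/-- The entropy of a linear image of a uniform vector is its rank, in units of `log |F|`. -/
theorem ent_linearMap {Ω : Type*} [MeasurableSpace Ω] {μ : Measure Ω} [IsProbabilityMeasure μ]
    {F : Type*} [Field F] [Fintype F] {E B : Type*} [AddCommGroup E] [Module F E] [Fintype E]
    [AddCommGroup B] [Module F B] [Fintype B] {Θ : Ω → E} (h : IsUnif μ Θ) (f : E →ₗ[F] B) :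
    ent μ (fun ω => f (Θ ω)) =
      (Module.finrank F E - Module.finrank F (LinearMap.ker f) : ℝ) *
        Real.log (Fintype.card F) := by
  classical
  set c : ℝ := (Fintype.card F : ℝ) with hc
  have hc0 : 0 < c := by rw [hc]; exact_mod_cast Fintype.card_pos
  set m := Module.finrank F (LinearMap.ker f)
  set r := Module.finrank F (LinearMap.range f)
  have hrank : r + m = Module.finrank F E := f.finrank_range_add_finrank_ker
  have hE : (Fintype.card E : ℝ) = c ^ (r + m) := by
    rw [hrank, Module.card_eq_pow_finrank (K := F)]; push_cast; rfl
  have hm : (Fintype.card (LinearMap.ker f) : ℝ) = c ^ m := by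
    rw [Module.card_eq_pow_finrank (K := F)]; push_cast; rfl
  have hr : (Fintype.card (LinearMap.range f) : ℝ) = c ^ r := by
    rw [Module.card_eq_pow_finrank (K := F)]; push_cast; rfl
  have hterm (b : B) : Real.negMulLog (μ ((fun ω => f (Θ ω)) ⁻¹' {b})).toReal =
      if b ∈ LinearMap.range f then (c ^ r)⁻¹ * (r * Real.log c) else 0 := by
    have hpre : (fun ω => f (Θ ω)) ⁻¹' {b} =
        Θ ⁻¹' ((Finset.univ.filter fun e => f e = b : Finset E) : Set E) := by ext; simp
    rw [hpre, h.measure_preimage]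
    split_ifs with hb
    · obtain ⟨e₀, rfl⟩ := hb
      have hfib : (Finset.univ.filter fun e => f e = f e₀).card =
          Fintype.card (LinearMap.ker f) := by
        rw [← Fintype.card_subtype]
        exact Fintype.card_congr
          { toFun := fun e => ⟨e.1 - e₀, by simp [e.2]⟩
            invFun := fun e => ⟨e.1 + e₀, by simp [LinearMap.mem_ker.1 e.2]⟩
            left_inv := fun e => by simp
            right_inv := fun e => by simp }
      have hdiv : c ^ m / c ^ (r + m) = (c ^ r)⁻¹ := by
        rw [pow_add]; field_simp
      rw [hfib, hm, hE, hdiv, Real.negMulLog, Real.log_inv, Real.log_pow]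
      ring
    · have : (Finset.univ.filter fun e => f e = b) = ∅ := by
        ext e
        simp only [Finset.mem_filter, Finset.mem_univ, true_and, Finset.notMem_empty, iff_false]
        exact fun he => hb ⟨e, he⟩
      simp [this]
  have hcard : ((Finset.univ.filter fun b => b ∈ LinearMap.range f).card : ℝ) = c ^ r := by
    rw [← hr, ← Fintype.card_subtype]
  rw [ent, Finset.sum_congr rfl fun b _ => hterm b, ← Finset.sum_filter, Finset.sum_const,
    nsmul_eq_mul, hcard, mul_inv_cancel_left₀ (pow_pos hc0 r).ne', ← hrank]
  push_cast
  ring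

/-- Linear images `X`, `Y` of a uniform vector are conditionally independent given the linear
image `Z` as soon as every value of `Y` on `ker Z` is attained on `ker X ⊓ ker Z`. -/
theorem condMutInfo_linearMap_eq_zero {Ω : Type*} [MeasurableSpace Ω] {μ : Measure Ω}
    [IsProbabilityMeasure μ] {F : Type*} [Field F] [Fintype F] {E A B C : Type*}
    [AddCommGroup E] [Module F E] [Fintype E] [AddCommGroup A] [Module F A] [Fintype A]
    [AddCommGroup B] [Module F B] [Fintype B] [AddCommGroup C] [Module F C] [Fintype C]
    {Θ : Ω → E} (h : IsUnif μ Θ) (X : E →ₗ[F] A) (Y : E →ₗ[F] B) (Z : E →ₗ[F] C)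
    (hXYZ : ∀ e, Z e = 0 → ∃ e', Z e' = 0 ∧ X e' = 0 ∧ Y e' = Y e) :
    condMutInfo μ (fun ω => X (Θ ω)) (fun ω => Y (Θ ω)) (fun ω => Z (Θ ω)) = 0 := by
  have hXZ : ent μ (fun ω => (X (Θ ω), Z (Θ ω))) = _ := ent_linearMap h (X.prod Z)
  have hYZ : ent μ (fun ω => (Y (Θ ω), Z (Θ ω))) = _ := ent_linearMap h (Y.prod Z)
  have hXYZ' : ent μ (fun ω => (X (Θ ω), Y (Θ ω), Z (Θ ω))) = _ :=
    ent_linearMap h (X.prod (Y.prod Z))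
  have hZ := ent_linearMap h Z
  have hinf : LinearMap.ker (X.prod Z) ⊓ LinearMap.ker (Y.prod Z) =
      LinearMap.ker (X.prod (Y.prod Z)) := by
    simp only [LinearMap.ker_prod]
    ext e
    simp only [Submodule.mem_inf]
    tauto
  have hsup : LinearMap.ker (X.prod Z) ⊔ LinearMap.ker (Y.prod Z) = LinearMap.ker Z := by
    simp only [LinearMap.ker_prod]
    refine le_antisymm (sup_le inf_le_right inf_le_right) fun e he => ?_
    obtain ⟨e', hZe', hXe', hYe'⟩ := hXYZ e he
    rw [Submodule.mem_sup]
    refine ⟨e', ⟨hXe', hZe'⟩, e - e', ⟨?_, ?_⟩, by abel⟩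
    · simp [hYe']
    · simp [hZe', LinearMap.mem_ker.1 he]
  have hdim := Submodule.finrank_sup_add_finrank_inf_eq
    (LinearMap.ker (X.prod Z)) (LinearMap.ker (Y.prod Z))
  rw [hinf, hsup] at hdim
  have hdim' : (Module.finrank F (LinearMap.ker Z) : ℝ) +
      Module.finrank F (LinearMap.ker (X.prod (Y.prod Z))) =
      Module.finrank F (LinearMap.ker (X.prod Z)) +
        Module.finrank F (LinearMap.ker (Y.prod Z)) := by exact_mod_cast hdim
  rw [condMutInfo, hXZ, hYZ, hXYZ', hZ]
  linear_combination Real.log (Fintype.card F) * hdim'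

/-- Mutually independent uniform families are jointly uniform. -/
theorem isUnif_triple {Ω : Type*} [MeasurableSpace Ω] {μ : Measure Ω}
    {ι : Type*} [Fintype ι] [DecidableEq ι] {A B C : Type u} [Fintype A] [Fintype B] [Fintype C]
    {X : ι → Ω → A} {Y : ι → Ω → B} {Z : ι → Ω → C}
    (hindep : iIndepRV μ (tripleFam X Y Z)) (hX : ∀ i, IsUnif μ (X i))
    (hY : ∀ i, IsUnif μ (Y i)) (hZ : ∀ i, IsUnif μ (Z i)) :
    IsUnif μ (fun ω => ((fun i => X i ω, fun i => Y i ω, fun i => Z i ω) :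
      (ι → A) × (ι → B) × (ι → C))) := by
  rintro ⟨x, y, z⟩
  let a : (s : ι ⊕ ι ⊕ ι) → Sum.elim (fun _ : ι => A)
      (Sum.elim (fun _ : ι => B) (fun _ : ι => C)) s
    | Sum.inl i => x i
    | Sum.inr (Sum.inl i) => y i
    | Sum.inr (Sum.inr i) => z i
  have hset : (fun ω => ((fun i => X i ω, fun i => Y i ω, fun i => Z i ω) :
      (ι → A) × (ι → B) × (ι → C))) ⁻¹' {(x, y, z)} = ⋂ s, tripleFam X Y Z s ⁻¹' {a s} := by
    ext ω
    simp only [Set.mem_preimage, Set.mem_singleton_iff, Prod.mk.injEq, funext_iff,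
      Set.mem_iInter, Sum.forall]
    rfl
  rw [hset, hindep a, Fintype.prod_sum_type, Fintype.prod_sum_type]
  change (∏ i, μ (X i ⁻¹' {x i})) * ((∏ i, μ (Y i ⁻¹' {y i})) * ∏ i, μ (Z i ⁻¹' {z i})) = _
  simp only [hX _ _, hY _ _, hZ _ _, Finset.prod_const, Fintype.card_prod, Fintype.card_fun,
    Finset.card_univ, Nat.cast_mul, Nat.cast_pow, ← ENNReal.inv_pow]
  rw [ENNReal.mul_inv (.inr (by finiteness)) (.inl (by finiteness)),
    ENNReal.mul_inv (.inr (by finiteness)) (.inl (by finiteness))]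

/-- The key projection of a single mask `n` and pad `s` onto a column of `α`. -/
def keyProj {F : Type*} [CommRing F] {ι : Type*} {L T k : ℕ} (hk : k = L + T)
    (α : Matrix (Fin k) ι F) (uv : ι) : (Fin L → F) × (Fin T → F) →ₗ[F] F where
  toFun p := ∑ r : Fin k,
    (if h : r.val < L then p.1 ⟨r.val, h⟩ else p.2 ⟨r.val - L, by omega⟩) * α r uv
  map_add' p p' := by
    rw [← Finset.sum_add_distrib]
    refine Finset.sum_congr rfl fun r _ => ?_
    split_ifs <;> simp [add_mul]
  map_smul' c p := by
    rw [RingHom.id_apply, smul_eq_mul, Finset.mul_sum]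
    refine Finset.sum_congr rfl fun r _ => ?_
    split_ifs <;> simp [mul_assoc]

/-- With zero mask, `keyProj` only involves the last `T` rows of `α`. -/
theorem keyProj_pad {F : Type*} [CommRing F] {ι : Type*} {L T k : ℕ} (hk : k = L + T)
    (hTk : T ≤ k) (α : Matrix (Fin k) ι F) (uv : ι) (s : Fin T → F) :
    keyProj hk α uv (0, s) =
      ∑ t : Fin T, s t * α (⟨k - T + t.val, by omega⟩ : Fin k) uv := by
  subst hk
  simp only [keyProj, LinearMap.coe_mk, AddHom.coe_mk, Fin.sum_univ_add]
  simp [Fin.natAdd]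

/-- For a `T`-private matrix, any mask can be completed linearly by a pad so that the key
projections onto at most `T` prescribed columns vanish. -/
theorem IsTPrivate.exists_pad {F : Type*} [Field F] {ι : Type*} [Fintype ι] [DecidableEq ι]
    {L T k : ℕ} (hk : k = L + T) (hTk : T ≤ k) {α : Matrix (Fin k) ι F}
    (hα : IsTPrivate α T hTk) (hι : T ≤ Fintype.card ι) (𝒯 : Finset ι) (h𝒯 : 𝒯.card ≤ T) :
    ∃ G : (Fin L → F) →ₗ[F] (Fin T → F), ∀ n, ∀ i ∈ 𝒯, keyProj hk α i (n, G n) = 0 := by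
  obtain ⟨𝒯', hsub, -, hcard⟩ := Finset.exists_subsuperset_card_eq 𝒯.subset_univ h𝒯 (by simpa)
  let e := 𝒯'.equivFinOfCardEq hcard
  let M : Matrix (Fin T) (Fin T) F := Matrix.of fun i j : Fin T =>
    α (⟨k - T + i.val, by omega⟩ : Fin k) (e.symm j).1
  have hM : IsUnit M.det :=
    hα (fun j => (e.symm j).1) (Subtype.val_injective.comp e.symm.injective)
  let R : (Fin L → F) →ₗ[F] (Fin T → F) := LinearMap.pi fun j =>
    (keyProj hk α (e.symm j).1).comp (LinearMap.inl F (Fin L → F) (Fin T → F))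
  refine ⟨-(M⁻¹.vecMulLinear.comp R), fun n i hi => ?_⟩
  have hpad : keyProj hk α i (0, M⁻¹.vecMulLinear (R n)) = keyProj hk α i (n, 0) := by
    have hmul : Matrix.vecMul (Matrix.vecMul (R n) M⁻¹) M = R n := by
      rw [Matrix.vecMul_vecMul, Matrix.nonsing_inv_mul _ hM, Matrix.vecMul_one]
    have := congrFun hmul (e ⟨i, hsub hi⟩)
    rw [keyProj_pad hk hTk]
    simpa [Matrix.vecMul, dotProduct, M, R] using this
  have hsplit : (n, (-(M⁻¹.vecMulLinear.comp R)) n) =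
      ((n, 0) - (0, M⁻¹.vecMulLinear (R n)) : (Fin L → F) × (Fin T → F)) := by
    ext <;> simp
  rw [hsplit, map_sub, hpad, sub_self]

/-- **Server security of the general achievable scheme.** For every admissible pattern
and every colluding set `𝒯` with `|𝒯| ≤ T`, the messages observed by the server (under
delayed message availability) reveal nothing about the users' inputs beyond the desired
sum and the colluding users' own inputs and keys. -/
theorem general_scheme_server_security
    {Ω : Type} [MeasurableSpace Ω] (μ : Measure Ω) [IsProbabilityMeasure μ]
    (F : Type) [Field F] [Fintype F]
    (U V U₀ V₀ T L k : ℕ) (hU : 2 ≤ U) (hV : 2 ≤ V)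
    (hU₀ : 1 ≤ U₀) (hU₀' : U₀ ≤ U - 1) (hV₀ : 1 ≤ V₀) (hV₀' : V₀ ≤ V - 1)
    (hT : T < U₀ * V₀) (hkUV : k = U₀ * V₀) (hkLT : k = L + T) (hTk : T ≤ k)
    (α : Matrix (Fin k) (Fin U × Fin V) F)
    (hαMDS : IsMDS α) (hαpriv : IsTPrivate α T hTk)
    (W N : Fin U × Fin V → Ω → Fin L → F) (S : Fin U × Fin V → Ω → Fin T → F)
    (hindep : iIndepRV μ (tripleFam W N S))
    (hWunif : ∀ i, IsUnif μ (W i)) (hNunif : ∀ i, IsUnif μ (N i))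
    (hSunif : ∀ i, IsUnif μ (S i))
    (P : Pattern U V U₀ V₀)
    (Q : Fin U → Finset (Fin V)) (hQsub : ∀ u, Q u ⊆ P.V2 u)
    (hQcard : ∀ u, (Q u).card = V₀)
    (𝒯 : Finset (Fin U × Fin V)) (h𝒯 : 𝒯.card ≤ T) :
    condMutInfo μ
      (fun ω => ((fun u : Fin U => ∑ v ∈ P.V1 u, (W (u, v) ω + N (u, v) ω)),
                 (fun u : {u // u ∈ P.U1} => fun v : {v // v ∈ Q u.1} =>
                    ∑ ij ∈ P.S1, QQ hkLT α N S ij (u.1, v.1) ω)))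
      (fun ω => fun i : Fin U × Fin V => W i ω)
      (fun ω => ((∑ i ∈ P.S1, W i ω),
                 (fun i : {i // i ∈ 𝒯} =>
                    (W i.1 ω, N i.1 ω,
                     fun ij : Fin U × Fin V => QQ hkLT α N S ij i.1 ω)))) = 0 := by
  have hTcard : T ≤ Fintype.card (Fin U × Fin V) := by
    rw [Fintype.card_prod, Fintype.card_fin, Fintype.card_fin]
    exact hT.le.trans (Nat.mul_le_mul (by omega) (by omega))
  obtain ⟨G, hG⟩ := hαpriv.exists_pad hkLT hTk hTcard 𝒯 h𝒯
  let E := (Fin U × Fin V → Fin L → F) × (Fin U × Fin V → Fin L → F) ×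
    (Fin U × Fin V → Fin T → F)
  let w (i : Fin U × Fin V) : E →ₗ[F] (Fin L → F) :=
    (LinearMap.proj i).comp (LinearMap.fst F _ _)
  let n (i : Fin U × Fin V) : E →ₗ[F] (Fin L → F) :=
    (LinearMap.proj i).comp ((LinearMap.fst F _ _).comp (LinearMap.snd F _ _))
  let s (i : Fin U × Fin V) : E →ₗ[F] (Fin T → F) :=
    (LinearMap.proj i).comp ((LinearMap.snd F _ _).comp (LinearMap.snd F _ _))
  let key (ij uv : Fin U × Fin V) : E →ₗ[F] F := (keyProj hkLT α uv).comp ((n ij).prod (s ij))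
  let X : E →ₗ[F] (Fin U → Fin L → F) ×
      ((u : {u // u ∈ P.U1}) → {v // v ∈ Q u.1} → F) :=
    (LinearMap.pi fun u => ∑ v ∈ P.V1 u, (w (u, v) + n (u, v))).prod
      (LinearMap.pi fun u => LinearMap.pi fun v => ∑ ij ∈ P.S1, key ij (u.1, v.1))
  let Z : E →ₗ[F] (Fin L → F) ×
      ({i // i ∈ 𝒯} → (Fin L → F) × (Fin L → F) × (Fin U × Fin V → F)) :=
    (∑ i ∈ P.S1, w i).prod
      (LinearMap.pi fun i => (w i.1).prod ((n i.1).prod (LinearMap.pi fun ij => key ij i.1)))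
  have hXval (x y z) : X (x, y, z) = (fun u => ∑ v ∈ P.V1 u, (x (u, v) + y (u, v)),
      fun u v => ∑ ij ∈ P.S1, keyProj hkLT α (u.1, v.1) (y ij, z ij)) :=
    Prod.ext (funext fun _ => LinearMap.sum_apply _ _ _)
      (funext fun _ => funext fun _ => LinearMap.sum_apply _ _ _)
  have hZval (x y z) : Z (x, y, z) = (∑ i ∈ P.S1, x i,
      fun i => (x i.1, y i.1, fun ij => keyProj hkLT α i.1 (y ij, z ij))) :=
    Prod.ext (LinearMap.sum_apply _ _ _) rfl
  have hker (e : E) (he : Z e = 0) :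
      ∃ e', Z e' = 0 ∧ X e' = 0 ∧ LinearMap.fst F _ _ e' = LinearMap.fst F _ _ e := by
    obtain ⟨x, y, z⟩ := e
    rw [hZval] at he
    have hsum : ∑ i ∈ P.S1, x i = 0 := congrArg Prod.fst he
    have hx (i : Fin U × Fin V) (hi : i ∈ 𝒯) : x i = 0 :=
      congrArg Prod.fst (congrFun (congrArg Prod.snd he) ⟨i, hi⟩)
    have hkey : ∑ i ∈ P.S1, ((-x i, G (-x i)) : (Fin L → F) × (Fin T → F)) = 0 := by
      ext : 1 <;> simp [Prod.fst_sum, Prod.snd_sum, ← map_sum, hsum]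
    refine ⟨(x, fun i => -x i, fun i => G (-x i)), ?_, ?_, rfl⟩
    · rw [hZval]
      exact Prod.ext hsum (funext fun i => Prod.ext (hx i.1 i.2)
        (Prod.ext (neg_eq_zero.2 (hx i.1 i.2)) (funext fun _ => hG _ i.1 i.2)))
    · rw [hXval]
      refine Prod.ext (funext fun u => ?_) (funext fun u => funext fun v => ?_)
      · simp
      · simp only [← map_sum, hkey, map_zero]
        rfl
  have hmain := condMutInfo_linearMap_eq_zero (isUnif_triple hindep hWunif hNunif hSunif)
    X (LinearMap.fst F _ _) Z hker
  simp only [hXval, hZval] at hmain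
  exact hmain
end

section
/- First-round revelation of a potentially dropping user. For any correct scheme and any user (u',v') ∈ [U]×[V], H[W_{u',v'} | (X¹_{u',v'}, {(W_{u,v}, Z_{u,v})}_{(u,v)∈([U]×[V])∖{(u',v')}})] = 0; that is, the input of any user (which may drop out after the first round) is almost surely determined by its own first-round message together with the inputs and keys of all other users. -/
open MeasureTheory Finset

/-- A subset of a finite measure space is null-measurable as soon as its outer measure and that of
its complement add up to at most the total mass. -/
lemma nullMeasurableSet_of_measure_add_compl_le {Ω : Type*} [MeasurableSpace Ω] {μ : Measure Ω}
    [IsFiniteMeasure μ] {A : Set Ω} (h : μ A + μ Aᶜ ≤ μ Set.univ) : NullMeasurableSet A μ := by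
  have hcover : toMeasurable μ A ∪ toMeasurable μ Aᶜ = Set.univ := by
    rw [Set.eq_univ_iff_forall]
    intro ω
    by_cases hω : ω ∈ A
    · exact Or.inl (subset_toMeasurable μ A hω)
    · exact Or.inr (subset_toMeasurable μ Aᶜ hω)
  have hinter : μ (toMeasurable μ A ∩ toMeasurable μ Aᶜ) = 0 := by
    have hadd := measure_union_add_inter (μ := μ) (toMeasurable μ A)
      (measurableSet_toMeasurable μ Aᶜ)
    rw [hcover, measure_toMeasurable, measure_toMeasurable] at hadd
    have hle : μ Set.univ + μ (toMeasurable μ A ∩ toMeasurable μ Aᶜ) ≤ μ Set.univ + 0 := by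
      rw [hadd, add_zero]
      exact h
    exact nonpos_iff_eq_zero.mp ((ENNReal.add_le_add_iff_left (measure_ne_top μ _)).mp hle)
  have hae : A =ᵐ[μ] toMeasurable μ A := by
    refine (subset_toMeasurable μ A).eventuallyLE.antisymm (ae_le_set.mpr ?_)
    exact measure_mono_null
      (Set.inter_subset_inter_right _ (subset_toMeasurable μ Aᶜ)) hinter
  exact (measurableSet_toMeasurable μ A).nullMeasurableSet.congr hae.symm

/-- The fibres of a uniformly distributed finitely-valued map are null-measurable. -/
lemma IsUnif.nullMeasurableSet_fiber {Ω : Type*} [MeasurableSpace Ω] {μ : Measure Ω}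
    [IsProbabilityMeasure μ] {α : Type*} [Fintype α] [Nonempty α] {X : Ω → α}
    (hX : IsUnif μ X) (a : α) : NullMeasurableSet (X ⁻¹' {a}) μ := by
  classical
  apply nullMeasurableSet_of_measure_add_compl_le
  have hcompl : (X ⁻¹' {a})ᶜ = ⋃ b ∈ univ.erase a, X ⁻¹' {b} := by
    ext ω
    simp
  have hsum : ∑ b, μ (X ⁻¹' {b}) = 1 := by
    simp only [hX _, sum_const, card_univ, nsmul_eq_mul]
    exact ENNReal.mul_inv_cancel (by simp) (by simp)
  rw [measure_univ, ← hsum, ← add_sum_erase _ _ (mem_univ a), hcompl]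
  gcongr
  exact measure_biUnion_finset_le _ _

/-- Any function of a finite family of finitely-valued maps with null-measurable fibres has
null-measurable fibres. -/
lemma nullMeasurableSet_preimage_pi {Ω : Type*} [MeasurableSpace Ω] {μ : Measure Ω}
    {ι α : Type*} [Finite ι] [Finite α] {X : ι → Ω → α}
    (hX : ∀ i a, NullMeasurableSet (X i ⁻¹' {a}) μ) (t : Set (ι → α)) :
    NullMeasurableSet {ω | (fun i => X i ω) ∈ t} μ := by
  have heq : {ω | (fun i => X i ω) ∈ t} = ⋃ w ∈ t, ⋂ i, X i ⁻¹' {w i} := by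
    ext ω
    simp only [Set.mem_ofPred_eq, Set.mem_iUnion, Set.mem_iInter, Set.mem_preimage,
      Set.mem_singleton_iff, exists_prop]
    refine ⟨fun h => ⟨_, h, fun _ => rfl⟩, ?_⟩
    rintro ⟨w, hw, h⟩
    rwa [show (fun i => X i ω) = w from funext h]
  rw [heq]
  exact NullMeasurableSet.biUnion t.to_countable
    fun w _ => NullMeasurableSet.iInter fun i => hX i (w i)

/-- Outer measure is additive along the fibres of a map whose fibres are null-measurable, on
arbitrary sets. -/
lemma measure_eq_sum_inter_fiber {Ω : Type*} [MeasurableSpace Ω] {μ : Measure Ω}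
    {α : Type*} [Fintype α] {X : Ω → α} (hX : ∀ a, NullMeasurableSet (X ⁻¹' {a}) μ)
    (T : Set Ω) : μ T = ∑ a, μ (X ⁻¹' {a} ∩ T) := by
  have hX' : ∀ a, NullMeasurableSet (X ⁻¹' {a}) (μ.restrict T) :=
    fun a => (hX a).mono Measure.restrict_le_self
  have hcover : ⋃ a, X ⁻¹' {a} = Set.univ := by
    ext ω
    simp
  have hdisj : Pairwise (Function.onFun (AEDisjoint (μ.restrict T)) fun a => X ⁻¹' {a}) :=
    fun a b hab => (Disjoint.preimage X (by simpa using hab)).aedisjoint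
  rw [← Measure.restrict_apply_univ, ← hcover, measure_iUnion₀ hdisj hX', tsum_fintype]
  exact sum_congr rfl fun a _ => Measure.restrict_apply₀ (hX' a)

/-- If `X` has null-measurable fibres, then `H[X | Y] = 0` exactly when no value of `Y` is
compatible with two different values of `X`. -/
lemma condEnt_eq_zero_iff {Ω : Type*} [MeasurableSpace Ω] {μ : Measure Ω} [IsFiniteMeasure μ]
    {α β : Type*} [Fintype α] [Fintype β] {X : Ω → α}
    (hX : ∀ a, NullMeasurableSet (X ⁻¹' {a}) μ) (Y : Ω → β) :
    condEnt μ X Y = 0 ↔ ∀ y, ∀ a b, a ≠ b →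
      μ (X ⁻¹' {a} ∩ Y ⁻¹' {y}) = 0 ∨ μ (X ⁻¹' {b} ∩ Y ⁻¹' {y}) = 0 := by
  classical
  set p : α → β → ℝ := fun a y => (μ (X ⁻¹' {a} ∩ Y ⁻¹' {y})).toReal with hp
  have hp0 : ∀ a y, 0 ≤ p a y := fun a y => ENNReal.toReal_nonneg
  have hP : ∀ y, (μ (Y ⁻¹' {y})).toReal = ∑ a, p a y := by
    intro y
    rw [measure_eq_sum_inter_fiber hX, ENNReal.toReal_sum fun a _ => measure_ne_top μ _]
  have hle : ∀ a y, p a y ≤ ∑ b, p b y :=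
    fun a y => single_le_sum (fun b _ => hp0 b y) (mem_univ a)
  have hent : condEnt μ X Y =
      ∑ y, ∑ a, p a y * (Real.log (∑ b, p b y) - Real.log (p a y)) := by
    have hpair : ∀ a y, (fun ω => (X ω, Y ω)) ⁻¹' {(a, y)} = X ⁻¹' {a} ∩ Y ⁻¹' {y} := by
      intro a y
      ext ω
      simp
    simp only [condEnt, ent, Fintype.sum_prod_type, hpair, hP]
    rw [sum_comm, ← sum_sub_distrib]
    refine sum_congr rfl fun y _ => ?_
    simp only [mul_sub, sum_sub_distrib, ← sum_mul, Real.negMulLog, neg_mul, sum_neg_distrib, hp]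
    ring
  have hterm : ∀ a y, 0 ≤ p a y * (Real.log (∑ b, p b y) - Real.log (p a y)) := by
    intro a y
    rcases (hp0 a y).eq_or_lt with h | h
    · simp [← h]
    · exact mul_nonneg h.le (sub_nonneg.mpr (Real.log_le_log h (hle a y)))
  have hzero : ∀ a y, μ (X ⁻¹' {a} ∩ Y ⁻¹' {y}) = 0 ↔ p a y = 0 := by
    intro a y
    simp [hp, ENNReal.toReal_eq_zero_iff]
  simp only [hent, hzero]
  rw [sum_eq_zero_iff_of_nonneg fun y _ => sum_nonneg fun a _ => hterm a y]
  simp only [mem_univ, true_implies, sum_eq_zero_iff_of_nonneg fun a _ => hterm a _]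
  refine forall_congr' fun y => ⟨fun h a b hab => ?_, fun h a => ?_⟩
  · by_contra! hne
    have hfull : p a y = ∑ c, p c y := by
      have hlog := (mul_eq_zero.mp (h a)).resolve_left hne.1
      have hpos : 0 < p a y := (hp0 a y).lt_of_ne' hne.1
      exact Real.log_injOn_pos hpos (hpos.trans_le (hle a y)) (by linarith)
    have hpair : p a y + p b y ≤ ∑ c, p c y := by
      rw [← sum_pair (f := fun c => p c y) hab]
      exact sum_le_univ_sum_of_nonneg fun c => hp0 c y
    have hpos : 0 < p b y := (hp0 b y).lt_of_ne' hne.2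
    linarith
  · by_cases ha : p a y = 0
    · simp [ha]
    · have hsingle : ∑ b, p b y = p a y :=
        Fintype.sum_eq_single a fun b hb => (h a b hb.symm).resolve_left ha
      simp [hsingle]

/-- The pattern in which everyone survives except that user `i` drops out after the first
round. -/
def Pattern.dropSecond {U V U₀ V₀ : ℕ} (hU₀ : U₀ ≤ U) (hV₀ : V₀ ≤ V - 1)
    (i : Fin U × Fin V) : Pattern U V U₀ V₀ where
  V1 _ := univ
  V2 u := univ.filter fun v => (u, v) ≠ i
  U1 := univ
  U2 := univ
  hVsub _ := subset_univ _
  hVcard u := by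
    have hsub : univ.erase i.2 ⊆ univ.filter fun v => (u, v) ≠ i := by
      intro v hv
      simp only [mem_filter, mem_univ, true_and]
      rintro rfl
      simp at hv
    refine le_trans ?_ (card_le_card hsub)
    simpa using hV₀
  hUsub := subset_univ _
  hUcard := by simpa using hU₀

lemma Pattern.dropSecond_S1 {U V U₀ V₀ : ℕ} (hU₀ : U₀ ≤ U) (hV₀ : V₀ ≤ V - 1)
    (i : Fin U × Fin V) : (Pattern.dropSecond hU₀ hV₀ i).S1 = univ := by
  ext j
  simp [Pattern.S1, Pattern.dropSecond]

/-- **First-round revelation of a potentially dropping user.** For any correct scheme and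
any user `(u',v')`, the input `W_{u',v'}` is almost surely determined by the user's own
first-round message together with the inputs and keys of all other users:
`H[W_{u',v'} | (X¹_{u',v'}, {(W_{u,v}, Z_{u,v})}_{(u,v)≠(u',v')})] = 0`. -/
theorem firstRound_reveals_user_input
    {Ω : Type} [MeasurableSpace Ω] (μ : Measure Ω) [IsProbabilityMeasure μ]
    (F : Type) [Field F] [Fintype F]
    (U V L U₀ V₀ T : ℕ) (hU : 2 ≤ U) (hV : 2 ≤ V) (hL : 1 ≤ L)
    (hU₀ : 1 ≤ U₀) (hU₀' : U₀ ≤ U - 1) (hV₀ : 1 ≤ V₀) (hV₀' : V₀ ≤ V - 1)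
    (K : Fin U × Fin V → Type) [∀ i, Fintype (K i)]
    (W : Fin U × Fin V → Ω → Fin L → F) (Z : (i : Fin U × Fin V) → Ω → K i)
    (hWindep : iIndepRV μ W) (hWunif : ∀ i, IsUnif μ (W i))
    (hWZ : IndepRV μ (fun ω => fun i => W i ω) (fun ω => fun i => Z i ω))
    (LX1 LY1 LX2 LY2 : ℕ)
    (S : Scheme U V U₀ V₀ L F K Ω W Z LX1 LY1 LX2 LY2)
    (hcorrect : S.Correct μ)
    (i' : Fin U × Fin V) :
    condEnt μ (W i')
      (fun ω => (S.X1 i' ω,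
        fun j : {j : Fin U × Fin V // j ≠ i'} => (W j.1 ω, Z j.1 ω))) = 0 := by
  have hWnull : ∀ i a, NullMeasurableSet (W i ⁻¹' {a}) μ :=
    fun i => (hWunif i).nullMeasurableSet_fiber
  set P : Pattern U V U₀ V₀ := Pattern.dropSecond (by omega) hV₀' i'
  have hS1 : P.S1 = univ := Pattern.dropSecond_S1 _ _ _
  have hsum : ∀ s, NullMeasurableSet ((fun ω => ∑ i ∈ P.S1, W i ω) ⁻¹' {s}) μ :=
    fun s => nullMeasurableSet_preimage_pi hWnull {w | ∑ i ∈ P.S1, w i = s}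
  have hdecode := (condEnt_eq_zero_iff hsum _).mp (hcorrect P)
  rw [condEnt_eq_zero_iff (hWnull i')]
  intro y a b hab
  by_contra! hne
  -- On the event fixing the conditioning data, the server's view does not vary.
  have hview : ∀ ω ω', S.X1 i' ω = S.X1 i' ω' → (∀ j, j ≠ i' → W j ω = W j ω' ∧ Z j ω = Z j ω') →
      ((fun u : {u // u ∈ P.U1} => S.Y1 P u.1 ω), (fun u : {u // u ∈ P.U2} => S.Y2 P u.1 ω)) =
      ((fun u : {u // u ∈ P.U1} => S.Y1 P u.1 ω'),
        (fun u : {u // u ∈ P.U2} => S.Y2 P u.1 ω')) := by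
    intro ω ω' hX1 hothers
    refine Prod.ext (funext fun u => ?_) (funext fun u => ?_)
    · obtain ⟨g, hg⟩ := S.hY1 P u.1
      simp only [hg]
      congr 1
      funext v
      by_cases hv : (u.1, v.1) = i'
      · rw [hv, hX1]
      · obtain ⟨φ, hφ⟩ := S.hX1 (u.1, v.1)
        rw [hφ, hφ, (hothers _ hv).1, (hothers _ hv).2]
    · obtain ⟨g, hg⟩ := S.hY2 P u.1
      simp only [hg]
      congr 1
      funext v
      have hv : (u.1, v.1) ≠ i' := (mem_filter.mp v.2).2
      obtain ⟨ψ, hψ⟩ := S.hX2 P.S1 (u.1, v.1)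
      rw [hψ, hψ, (hothers _ hv).1, (hothers _ hv).2]
  obtain ⟨ω₀, -, hω₀⟩ := nonempty_of_measure_ne_zero hne.1
  have hlift : ∀ c, W i' ⁻¹' {c} ∩ (fun ω => (S.X1 i' ω,
        fun j : {j : Fin U × Fin V // j ≠ i'} => (W j.1 ω, Z j.1 ω))) ⁻¹' {y} ⊆
      (fun ω => ∑ i ∈ P.S1, W i ω) ⁻¹' {c + ∑ i ∈ univ.erase i', W i ω₀} ∩
      (fun ω => ((fun u : {u // u ∈ P.U1} => S.Y1 P u.1 ω),
        (fun u : {u // u ∈ P.U2} => S.Y2 P u.1 ω))) ⁻¹'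
        {((fun u : {u // u ∈ P.U1} => S.Y1 P u.1 ω₀),
          (fun u : {u // u ∈ P.U2} => S.Y2 P u.1 ω₀))} := by
    rintro c ω ⟨hc, hω⟩
    have heq := hω.trans hω₀.symm
    have hothers : ∀ j, j ≠ i' → W j ω = W j ω₀ ∧ Z j ω = Z j ω₀ := fun j hj =>
      Prod.ext_iff.mp (congrFun (congrArg Prod.snd heq) ⟨j, hj⟩)
    refine ⟨?_, hview ω ω₀ (congrArg Prod.fst heq) hothers⟩
    change ∑ i ∈ P.S1, W i ω = _
    rw [hS1, ← add_sum_erase _ _ (mem_univ i'), show W i' ω = c from hc]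
    exact congrArg (c + ·) (sum_congr rfl fun j hj => (hothers j (ne_of_mem_erase hj)).1)
  rcases hdecode _ _ _ (fun h => hab (add_right_cancel h)) with h | h
  · exact hne.1 (measure_mono_null (hlift a) h)
  · exact hne.2 (measure_mono_null (hlift b) h)
end
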